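/- Let B be an unbalanced signed graph of order n whose underlying graph is bicyclic (connected with exactly n + 1 edges). Then η(B) ≤ n − 3, with equality if and only if n = 4, the underlying graph of B is Θ(2,2,1) (two triangles sharing a common edge, i.e. K₄ minus one edge), and both triangles of B are unbalanced (the product of the edge signs of each triangle is −1). -/

import Mathlib

/- The adjacency matrix of a signed graph `(G, σ)`: the `(u,v)` entry is `σ u v`
if `uv` is an edge of `G`, and `0` otherwise. -/
open Classical in
noncomputable def signedAdj {V : Type*} (G : SimpleGraph V) (σ : V → V → ℝ) :
    Matrix V V ℝ :=
  Matrix.of fun u v => if G.Adj u v then σ u v else 0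

/-- The sign of a walk: the product of the signs of its edges. -/
def walkSign {V : Type*} {G : SimpleGraph V} (σ : V → V → ℝ) {u v : V}
    (p : G.Walk u v) : ℝ :=
  (p.darts.map fun d => σ d.toProd.1 d.toProd.2).prod

/-- A signed graph is balanced if every cycle is positive. -/
def IsBalanced {V : Type*} (G : SimpleGraph V) (σ : V → V → ℝ) : Prop :=
  ∀ (u : V) (c : G.Walk u u), c.IsCycle → walkSign σ c = 1

lemma det4_aux (p q r a b c a' b' c' d : ℝ) :
    (!![0, p, r, a'; p, 0, q, b'; r, q, 0, c'; a, b, c, d] : Matrix (Fin 4) (Fin 4) ℝ).det =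
      2*p*q*r*d + q^2*a*a' + r^2*b*b' + p^2*c*c' - q*r*(a*b'+b*a') - p*q*(a*c'+c*a')
        - p*r*(b*c'+c*b') := by
  simp [Matrix.det_succ_row_zero, Fin.sum_univ_succ, Fin.succAbove]
  ring

lemma det_sub_zero {V : Type*} [Fintype V] (A : Matrix V V ℝ) {k : ℕ} (h : A.rank < k)
    (f g : Fin k → V) : (A.submatrix f g).det = 0 := by
  by_contra hd
  have h1 := Matrix.rank_of_det_ne_zero hd
  have h2 := Matrix.rank_submatrix_le A f g
  simp at h1
  omega

lemma minor4 {V : Type*} [Fintype V] (A : Matrix V V ℝ) (hs : ∀ x y, A x y = A y x)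
    (h0 : ∀ x, A x x = 0) (h : A.rank ≤ 3) (u v w x y : V) :
    2*A u v*A v w*A u w*A x y + (A v w)^2*A x u*A u y + (A u w)^2*A x v*A v y
      + (A u v)^2*A x w*A w y - A v w*A u w*(A x u*A v y+A x v*A u y)
      - A u v*A v w*(A x u*A w y+A x w*A u y)
        - A u v*A u w*(A x v*A w y+A x w*A v y) = 0 := by
  have := det_sub_zero A (k := 4) (by omega) ![u, v, w, x] ![u, v, w, y]
  rw [← this, ← det4_aux]
  congr 1
  ext i j
  fin_cases i <;> fin_cases j <;> simp [h0, hs v u, hs w u, hs w v]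

lemma rank_ge_three {V : Type*} [Fintype V] (A : Matrix V V ℝ) (hs : ∀ x y, A x y = A y x)
    (h0 : ∀ x, A x x = 0) (u v w : V) (h : A u v * A v w * A u w ≠ 0) : 3 ≤ A.rank := by
  by_contra hc
  have := det_sub_zero A (k := 3) (by omega) ![u, v, w] ![u, v, w]
  rw [Matrix.det_fin_three] at this
  simp [h0, hs v u, hs w u, hs w v] at this
  apply h
  linarith

lemma balanced_of_switch {V : Type*} (G : SimpleGraph V) (σ : V → V → ℝ) (d : V → ℝ)
    (hd : ∀ x, d x * d x = 1) (h : ∀ x y, G.Adj x y → σ x y = d x * d y) : IsBalanced G σ := by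
  have key : ∀ (u v : V) (p : G.Walk u v), walkSign σ p = d u * d v := by
    intro u v p
    induction p with
    | nil => simp [walkSign, hd]
    | cons hadj p ih =>
      rename_i a b c
      have : walkSign σ (SimpleGraph.Walk.cons hadj p) = σ a b * walkSign σ p := by
        simp [walkSign]
      rw [this, ih, h _ _ hadj]
      linear_combination (d a * d c) * hd b
  intro u c _
  rw [key, hd]

lemma sq_one {s : ℝ} (h : s = 1 ∨ s = -1) : s * s = 1 := by
  rcases h with rfl | rfl <;> norm_num

section
variable {V : Type*} (G : SimpleGraph V) (σ : V → V → ℝ)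

lemma sadj {x y : V} (h : G.Adj x y) : signedAdj G σ x y = σ x y := by simp [signedAdj, h]
lemma snadj {x y : V} (h : ¬ G.Adj x y) : signedAdj G σ x y = 0 := by simp [signedAdj, h]

/-- If the Schur complement of an edge vanishes, the graph is balanced. -/
lemma balanced_of_schur (hsgn : ∀ u v, G.Adj u v → σ u v = 1 ∨ σ u v = -1)
    (hsym : ∀ u v, σ u v = σ v u)
    (u v : V) (huv : G.Adj u v) (hno : ∀ x, ¬ (G.Adj u x ∧ G.Adj v x))
    (h : ∀ x y, signedAdj G σ x y = σ u v *
      (signedAdj G σ v x * signedAdj G σ u y + signedAdj G σ u x * signedAdj G σ v y)) :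
    IsBalanced G σ := by
  classical
  apply balanced_of_switch G σ
    (fun x => if G.Adj u x then σ u v * σ u x else if G.Adj v x then σ v x else 1)
  · intro x
    have huv' := sq_one (hsgn _ _ huv)
    split_ifs with h1 h2
    · have := sq_one (hsgn _ _ h1)
      linear_combination (σ u x * σ u x) * huv' + this
    · exact sq_one (hsgn _ _ h2)
    · norm_num
  · intro x y hxy
    have e := h x y
    have hne := sq_one (hsgn _ _ hxy)
    rw [sadj G σ hxy] at e
    have hx := hno x
    have hy := hno y
    clear h hsym hno hsgn
    by_cases h1 : G.Adj u x <;> by_cases h2 : G.Adj v x <;> by_cases h3 : G.Adj u y <;>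
      by_cases h4 : G.Adj v y <;> simp_all [signedAdj] <;> (try ring)

lemma key_tri (p q r a b c : ℝ) (hp : p = 1 ∨ p = -1) (hq : q = 1 ∨ q = -1)
    (hr : r = 1 ∨ r = -1) (ha : a = 0 ∨ a = 1 ∨ a = -1) (hb : b = 0 ∨ b = 1 ∨ b = -1)
    (hc : c = 0 ∨ c = 1 ∨ c = -1)
    (h : q^2*a*a + r^2*b*b + p^2*c*c - q*r*(a*b+b*a) - p*q*(a*c+c*a) - p*r*(b*c+c*b) = 0) :
    (a = 0 ∧ b = 0 ∧ c = 0) ∨ (c = 0 ∧ a * b = q * r ∧ a ≠ 0 ∧ b ≠ 0)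
      ∨ (b = 0 ∧ a * c = p * q ∧ a ≠ 0 ∧ c ≠ 0) ∨ (a = 0 ∧ b * c = p * r ∧ b ≠ 0 ∧ c ≠ 0) := by
  rcases hp with rfl | rfl <;> rcases hq with rfl | rfl <;> rcases hr with rfl | rfl <;>
    rcases ha with rfl | rfl | rfl <;> rcases hb with rfl | rfl | rfl <;>
    rcases hc with rfl | rfl | rfl <;> (try norm_num at h) <;> (try norm_num)

lemma count_le [Fintype V] (u v w : V) (huv : G.Adj u v) (hvw : G.Adj v w) (huw : G.Adj u w)
    (hbic : G.edgeSet.ncard = Fintype.card V + 1)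
    (h : ∀ x, x ≠ u → x ≠ v → x ≠ w → (G.Adj x u ∧ G.Adj x v) ∨ (G.Adj x u ∧ G.Adj x w) ∨
      (G.Adj x v ∧ G.Adj x w)) : Fintype.card V = 4 := by
  classical
  have h' : ∀ x, (G.Adj x u ∧ G.Adj x v) ∨ (G.Adj x u ∧ G.Adj x w) ∨
      (G.Adj x v ∧ G.Adj x w) := by
    intro x
    by_cases h1 : x = u
    · subst h1; simp [huv, huw]
    by_cases h2 : x = v
    · subst h2; simp [huv.symm, hvw]
    by_cases h3 : x = w
    · subst h3; simp [huw.symm, hvw.symm]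
    exact h x h1 h2 h3
  have hdeg : ∀ t, G.degree t = ∑ x, if G.Adj x t then 1 else 0 := by
    intro t
    rw [← SimpleGraph.card_neighborFinset_eq_degree, Finset.sum_boole]
    simp [SimpleGraph.neighborFinset_eq_filter, G.adj_comm]
  have hT : 2 * Fintype.card V ≤ G.degree u + G.degree v + G.degree w := by
    rw [hdeg, hdeg, hdeg, ← Finset.sum_add_distrib, ← Finset.sum_add_distrib]
    calc 2 * Fintype.card V = ∑ x : V, 2 := by simp [mul_comm]
      _ ≤ _ := by
        apply Finset.sum_le_sum
        intro x _
        rcases h' x with ⟨a, b⟩ | ⟨a, b⟩ | ⟨a, b⟩ <;> simp only [a, b, if_true] <;> omega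
  have hd2 : ∀ x, 2 ≤ G.degree x := by
    intro x
    have two : ∀ a b, a ≠ b → G.Adj x a → G.Adj x b → 2 ≤ G.degree x := by
      intro a b hab ha hb
      rw [← SimpleGraph.card_neighborFinset_eq_degree, ← Finset.card_pair hab]
      apply Finset.card_le_card
      intro y hy
      simp at hy
      rcases hy with rfl | rfl <;> simpa
    rcases h' x with ⟨a, b⟩ | ⟨a, b⟩ | ⟨a, b⟩
    · exact two _ _ huv.ne a b
    · exact two _ _ huw.ne a b
    · exact two _ _ hvw.ne a b
  have hcT : ({u, v, w} : Finset V).card = 3 := Finset.card_eq_three.2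
    ⟨u, v, w, huv.ne, huw.ne, hvw.ne, rfl⟩
  have hsum := G.sum_degrees_eq_twice_card_edges
  have hE : G.edgeFinset.card = Fintype.card V + 1 := by
    rw [← hbic, ← SimpleGraph.coe_edgeFinset, Set.ncard_coe_finset]
  have hchoose := G.card_edgeFinset_le_card_choose_two
  rw [← Finset.sum_add_sum_compl {u, v, w}] at hsum
  have s1 : ∑ i ∈ ({u, v, w} : Finset V), G.degree i = G.degree u + G.degree v + G.degree w := by
    rw [Finset.sum_insert (by simp [huv.ne, huw.ne]), Finset.sum_pair hvw.ne]; ring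
  have s2 : 2 * (Fintype.card V - 3) ≤ ∑ i ∈ ({u, v, w} : Finset V)ᶜ, G.degree i := by
    rw [← hcT, ← Finset.card_compl]
    have := Finset.card_nsmul_le_sum ({u, v, w} : Finset V)ᶜ (fun i => G.degree i) 2
      (fun x _ => hd2 x)
    simpa [mul_comm] using this
  have h3 : 3 ≤ Fintype.card V := by rw [← hcT]; exact Finset.card_le_univ _
  rw [hE] at hchoose hsum
  have h4 : Fintype.card V ≤ 4 := by omega
  interval_cases hV : Fintype.card V
  · simp [Nat.choose] at hchoose
  · rfl

/-- The final configuration. -/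
lemma finish [Fintype V] (hsym : ∀ u v, σ u v = σ v u)
    (hsgn : ∀ u v, G.Adj u v → σ u v = 1 ∨ σ u v = -1)
    (hunbal : ¬ IsBalanced G σ) (h4 : Fintype.card V = 4)
    (u v w x : V) (huv : G.Adj u v) (hvw : G.Adj v w) (huw : G.Adj u w)
    (hxu : G.Adj x u) (hxv : G.Adj x v) (hxw : ¬ G.Adj x w) (hw : x ≠ w)
    (hp : σ x u * σ x v = σ v w * σ u w) :
    ∃ x y z w : V, x ≠ y ∧ x ≠ z ∧ x ≠ w ∧ y ≠ z ∧ y ≠ w ∧ z ≠ w ∧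
        (∀ a : V, a = x ∨ a = y ∨ a = z ∨ a = w) ∧
        (∀ a b : V, G.Adj a b ↔
          s(a, b) ∈ ({s(x, y), s(x, z), s(y, z), s(x, w), s(y, w)} : Set (Sym2 V))) ∧
        σ x y * σ y z * σ z x = -1 ∧ σ x y * σ y w * σ w x = -1 := by
  classical
  have hcard : ({u, v, w, x} : Finset V).card = 4 := by
    rw [Finset.card_insert_of_notMem (by simp [huv.ne, huw.ne, hxu.ne.symm]),
      Finset.card_insert_of_notMem (by simp [hvw.ne, hxv.ne.symm]), Finset.card_pair hw.symm]
  have hall : ∀ a : V, a = u ∨ a = v ∨ a = w ∨ a = x := by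
    intro a
    have : ({u, v, w, x} : Finset V) = Finset.univ :=
      Finset.eq_univ_of_card _ (by rw [hcard, h4])
    have ha : a ∈ ({u, v, w, x} : Finset V) := by rw [this]; simp
    simpa using ha
  have n1 := huv.ne
  have n2 := huw.ne
  have n3 := hvw.ne
  have n4 := hxu.ne
  have n5 := hxv.ne
  have hwx : ¬ G.Adj w x := fun h => hxw h.symm
  have hneg : σ u v * σ v w * σ w u = -1 := by
    have e1 := sq_one (hsgn _ _ huv)
    have e2 := sq_one (hsgn _ _ hvw)
    have e3 := sq_one (hsgn _ _ huw)
    have e4 := sq_one (hsgn _ _ hxu)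
    have e5 := sq_one (hsgn _ _ hxv)
    by_contra hne
    have hpos : σ u v * σ v w * σ u w = 1 := by
      rw [hsym w u] at hne
      rcases hsgn _ _ huv with h | h <;> rcases hsgn _ _ hvw with h' | h' <;>
        rcases hsgn _ _ huw with h'' | h'' <;> rw [h, h', h''] at hne ⊢ <;> (try norm_num at hne) <;> (try norm_num)
    apply hunbal
    have evw : σ v w = σ u v * σ u w := by
      linear_combination (σ u v * σ u w) * hpos - σ v w * σ u v * σ u v * e3 - σ v w * e1
    have exv : σ x v = σ x u * σ u v := by
      linear_combination (σ x u) * hp - σ x v * e4 + σ x u * σ u w * evw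
        + σ x u * σ u v * e3
    refine balanced_of_switch G σ
      (fun t => if t = u then 1 else σ u t) ?_ ?_
    · intro t
      rcases hall t with rfl | rfl | rfl | rfl
      · simp
      · simp [n1.symm, e1]
      · simp [n2.symm, e3]
      · simp [n4, hsym u, e4]
    · intro a b hab
      rcases hall a with rfl | rfl | rfl | rfl <;> rcases hall b with rfl | rfl | rfl | rfl <;>
        first
        | exact absurd hab (G.irrefl)
        | exact absurd hab hxw
        | exact absurd hab hwx
        | (simp only [n1.symm, n2.symm, n4, if_true, if_false]
           first
           | ring1
           | (rw [hsym]; ring1)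
           | linear_combination evw
           | (rw [hsym]; linear_combination evw)
           | linear_combination exv + σ u v * hsym x u
           | (rw [hsym]; linear_combination exv + σ u v * hsym x u)
           | linear_combination exv + σ u b * hsym a u
           | (rw [hsym]; linear_combination exv + σ u a * hsym b u))
  refine ⟨u, v, w, x, n1, n2, n4.symm, n3, n5.symm, hw.symm, hall, ?_, hneg, ?_⟩
  · intro a b
    have m1 := huv.symm
    have m2 := huw.symm
    have m3 := hvw.symm
    have m4 := hxu.symm
    have m5 := hxv.symm
    rcases hall a with rfl | rfl | rfl | rfl <;> rcases hall b with rfl | rfl | rfl | rfl <;>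
      simp [*, n1.symm, n2.symm, n3.symm, n4.symm, n5.symm, hw.symm]
  · rw [hsym v x, ← hneg, hsym w u]
    linear_combination (σ u v) * hp

end

theorem nullity_unbalanced_bicyclic_le
    {V : Type*} [Fintype V] (G : SimpleGraph V) (σ : V → V → ℝ)
    (hsym : ∀ u v, σ u v = σ v u)
    (hsgn : ∀ u v, G.Adj u v → σ u v = 1 ∨ σ u v = -1)
    (hconn : G.Connected)
    (hbic : G.edgeSet.ncard = Fintype.card V + 1)
    (hunbal : ¬ IsBalanced G σ) :
    Fintype.card V - (signedAdj G σ).rank ≤ Fintype.card V - 3 ∧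
    (Fintype.card V - (signedAdj G σ).rank = Fintype.card V - 3 ↔
      Fintype.card V = 4 ∧
      ∃ x y z w : V, x ≠ y ∧ x ≠ z ∧ x ≠ w ∧ y ≠ z ∧ y ≠ w ∧ z ≠ w ∧
        (∀ a : V, a = x ∨ a = y ∨ a = z ∨ a = w) ∧
        (∀ a b : V, G.Adj a b ↔
          s(a, b) ∈ ({s(x, y), s(x, z), s(y, z), s(x, w), s(y, w)} : Set (Sym2 V))) ∧
        σ x y * σ y z * σ z x = -1 ∧ σ x y * σ y w * σ w x = -1) := by
  classical
  set A := signedAdj G σ with hA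
  have hs : ∀ x y, A x y = A y x := by
    intro x y
    simp [hA, signedAdj, G.adj_comm x y, hsym x y]
  have h0 : ∀ x, A x x = 0 := by intro x; simp [hA, signedAdj]
  have hadj : ∀ {x y}, G.Adj x y → A x y = σ x y := fun h => sadj G σ h
  have hnadj : ∀ {x y}, ¬ G.Adj x y → A x y = 0 := fun h => snadj G σ h
  have hpm : ∀ {x y}, G.Adj x y → A x y = 1 ∨ A x y = -1 := fun h => by
    rw [hadj h]; exact hsgn _ _ h
  have hne : ∀ {x y}, A x y ≠ 0 → G.Adj x y := fun h => by
    by_contra hc; exact h (hnadj hc)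
  have hne' : ∀ {x y}, G.Adj x y → A x y ≠ 0 := fun h => by
    rcases hpm h with h | h <;> rw [h] <;> norm_num
  have htri : ∀ x y, A x y = 0 ∨ A x y = 1 ∨ A x y = -1 := by
    intro x y
    by_cases h : G.Adj x y
    · exact Or.inr (hpm h)
    · exact Or.inl (hnadj h)
  -- an edge
  obtain ⟨e, he⟩ : G.edgeSet.Nonempty := by
    apply Set.nonempty_of_ncard_ne_zero; omega
  -- a triangle when the rank is at most 3
  have tri : A.rank ≤ 3 → ∃ u v w, G.Adj u v ∧ G.Adj v w ∧ G.Adj u w := by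
    intro hr
    induction e using Sym2.ind with
    | _ u v =>
    have huv : G.Adj u v := he
    by_contra hno
    push Not at hno
    apply hunbal
    have hno' : ∀ x, ¬ (G.Adj u x ∧ G.Adj v x) := fun x hx => hno u v x huv hx.2 hx.1
    have hz : ∀ x, A u x * A v x = 0 := by
      intro x
      by_contra hc
      exact hno' x ⟨hne (left_ne_zero_of_mul hc), hne (right_ne_zero_of_mul hc)⟩
    apply balanced_of_schur G σ hsgn hsym u v huv hno'
    intro x y
    have m := minor4 A hs h0 hr u v x y y
    have hu := sq_one (hpm huv)
    rw [← hadj huv]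
    change A x y = A u v * (A v x * A u y + A u x * A v y)
    rw [h0 y, hs y u, hs y v, hs y x] at m
    have : (A x y - A u v * (A v x * A u y + A u x * A v y))^2 = 0 := by
      linear_combination m + (-(A x y)^2 + (A v x * A u y + A u x * A v y)^2) * hu
        + (4 * A u y * A v y) * hz x
    have := pow_eq_zero_iff (two_ne_zero) |>.1 this
    linarith
  have hge : 3 ≤ A.rank := by
    by_contra hc
    obtain ⟨u, v, w, h1, h2, h3⟩ := tri (by omega)
    exact hc (rank_ge_three A hs h0 u v w
      (mul_ne_zero (mul_ne_zero (hne' h1) (hne' h2)) (hne' h3)))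
  have hle : A.rank ≤ Fintype.card V := A.rank_le_card_width
  refine ⟨by omega, ?_, ?_⟩
  · intro heq
    have hr : A.rank ≤ 3 := by omega
    obtain ⟨u, v, w, huv, hvw, huw⟩ := tri hr
    have main : ∀ x, x ≠ u → x ≠ v → x ≠ w →
        (¬ G.Adj x w ∧ A x u * A x v = A v w * A u w ∧ G.Adj x u ∧ G.Adj x v) ∨
        (¬ G.Adj x v ∧ A x u * A x w = A u v * A v w ∧ G.Adj x u ∧ G.Adj x w) ∨
        (¬ G.Adj x u ∧ A x v * A x w = A u v * A u w ∧ G.Adj x v ∧ G.Adj x w) := by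
      intro x hxu hxv hxw
      have m := minor4 A hs h0 hr u v w x x
      rw [h0 x, hs u x, hs v x, hs w x, mul_zero, zero_add] at m
      have z : ∀ y, A x y = 0 → ¬ G.Adj x y := fun y h h' => hne' h' h
      rcases key_tri _ _ _ _ _ _ (hpm huv) (hpm hvw) (hpm huw) (htri x u) (htri x v) (htri x w) m
        with ⟨a, b, c⟩ | ⟨a, b, c, d⟩ | ⟨a, b, c, d⟩ | ⟨a, b, c, d⟩
      · exfalso
        have : Nontrivial V := ⟨x, u, hxu⟩
        obtain ⟨y, hy⟩ := hconn.preconnected.exists_adj_of_nontrivial x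
        have m := minor4 A hs h0 hr u v w x y
        rw [a, b, c] at m
        have := hne' huv
        have := hne' hvw
        have := hne' huw
        have := hne' hy
        simp_all
      · exact Or.inl ⟨z _ a, b, hne c, hne d⟩
      · exact Or.inr (Or.inl ⟨z _ a, b, hne c, hne d⟩)
      · exact Or.inr (Or.inr ⟨z _ a, b, hne c, hne d⟩)
    have h4 : Fintype.card V = 4 := by
      refine count_le G u v w huv hvw huw hbic ?_
      intro x a b c
      have := main x a b c
      tauto
    refine ⟨h4, ?_⟩
    obtain ⟨x, hx⟩ : ∃ x, x ∉ ({u, v, w} : Finset V) := by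
      by_contra hc
      push Not at hc
      have h1 := Finset.card_le_three (a := u) (b := v) (c := w)
      rw [Finset.eq_univ_iff_forall.2 hc, Finset.card_univ] at h1
      omega
    simp only [Finset.mem_insert, Finset.mem_singleton, not_or] at hx
    obtain ⟨x1, x2, x3⟩ := hx
    rcases main x x1 x2 x3 with ⟨a, b, c, d⟩ | ⟨a, b, c, d⟩ | ⟨a, b, c, d⟩
    · refine finish G σ hsym hsgn hunbal h4 u v w x huv hvw huw c d a x3 ?_
      rwa [hadj c, hadj d, hadj hvw, hadj huw] at b
    · refine finish G σ hsym hsgn hunbal h4 u w v x huw hvw.symm huv c d a x2 ?_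
      rw [hadj c, hadj d, hadj hvw, hadj huv] at b
      rw [b, hsym w v, mul_comm]
    · refine finish G σ hsym hsgn hunbal h4 v w u x hvw huw.symm huv.symm c d a x1 ?_
      rw [hadj c, hadj d, hadj huw, hadj huv] at b
      rw [b, hsym w u, hsym v u, mul_comm]
  · rintro ⟨h4, x, y, z, w, xy, xz, xw, yz, yw, zw, hall, hG, t1, t2⟩
    suffices A.rank < 4 by omega
    by_contra hc
    have hrk : A.rank = Fintype.card V := by omega
    have axz : G.Adj x z := (hG _ _).2 (by simp)
    have ayz : G.Adj y z := (hG _ _).2 (by simp)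
    have axw : G.Adj x w := (hG _ _).2 (by simp)
    have ayw : G.Adj y w := (hG _ _).2 (by simp)
    have axy : G.Adj x y := (hG _ _).2 (by simp)
    have nzw : ¬ G.Adj z w := by
      rw [hG]; simp [xy, xz, xw, yz, yw, zw, xy.symm, xz.symm, xw.symm, yz.symm, yw.symm, zw.symm]
    have e1 := sq_one (hpm axz)
    have e2 := sq_one (hpm axw)
    have e3 := sq_one (hpm axy)
    have hprod : A x z * A y z = A x w * A y w := by
      rw [hsym z x, ← hadj axy, ← hadj ayz, ← hadj axz] at t1
      rw [hsym w x, ← hadj axy, ← hadj ayw, ← hadj axw] at t2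
      linear_combination A x y * (t1 - t2) - (A x z * A y z - A x w * A y w) * e3
    have hzero : A.mulVec (Pi.single z (A x w) + Pi.single w (- A x z)) = 0 := by
      ext t
      rw [Matrix.mulVec_add]
      simp only [Pi.add_apply, Matrix.mulVec_single, Pi.zero_apply, Pi.smul_apply, Matrix.col_apply,
        MulOpposite.smul_eq_mul_unop, MulOpposite.unop_op]
      rcases hall t with rfl | rfl | rfl | rfl
      · ring
      · linear_combination (A x z * A x w) * hprod - A t z * A x w * e1 + A t w * A x z * e2
      · rw [h0, hnadj nzw]; ring
      · rw [h0, hs, hnadj nzw]; ring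
    have htop : LinearMap.range A.mulVecLin = ⊤ := by
      apply Submodule.eq_top_of_finrank_eq
      rw [Module.finrank_fintype_fun_eq_card, ← hrk]
      rfl
    have hinj := LinearMap.injective_iff_surjective.2 (LinearMap.range_eq_top.1 htop)
    have hf := hinj ((Matrix.mulVecLin_apply _ _).trans (hzero.trans (map_zero A.mulVecLin).symm))
    have := congrFun hf z
    simp [zw] at this
    exact hne' axw this
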